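/- If f : ℝ → ℝ is r-times continuously differentiable with all derivatives bounded, r ≥ 1, then for δ > 0, δ^r ‖(T_δ^{2r} f)^{(r)}‖ ≤ 34^r ‖(I - T_δ)^r f‖ in the sup norm, where T_δ^{2r} is the 2r-fold iterate of T_δ. -/

import Mathlib

/-- Forward Steklov operator `T_δ f(x) = (1/δ) ∫₀^δ f(x+t) dt`. -/
noncomputable def steklov (δ : ℝ) (f : ℝ → ℝ) : ℝ → ℝ :=
  fun x => (1 / δ) * ∫ t in (0:ℝ)..δ, f (x + t)

/-- The difference operator `(I - T_δ) f`. -/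
noncomputable def steklovDiff (δ : ℝ) (f : ℝ → ℝ) : ℝ → ℝ :=
  fun x => f x - steklov δ f x

open Set

/-- The forward difference of the Steklov average, `x ↦ T_δ f(x + δ) - T_δ f(x)`. -/
noncomputable def steklovFwdDiff (δ : ℝ) (f : ℝ → ℝ) : ℝ → ℝ :=
  fun x => steklov δ f (x + δ) - steklov δ f x

theorem steklov_eq_integral (δ : ℝ) (f : ℝ → ℝ) (x : ℝ) :
    steklov δ f x = (1 / δ) * ∫ t in x..(x + δ), f t := by
  simp [steklov]

theorem hasDerivAt_steklov (δ : ℝ) {f : ℝ → ℝ} (hf : Continuous f) (x : ℝ) :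
    HasDerivAt (steklov δ f) ((1 / δ) * (f (x + δ) - f x)) x := by
  have hi (a b : ℝ) : IntervalIntegrable f MeasureTheory.volume a b := hf.intervalIntegrable a b
  have h (y : ℝ) : HasDerivAt (fun z => ∫ t in (0:ℝ)..z, f t) (f y) y :=
    hf.integral_hasStrictDerivAt 0 y |>.hasDerivAt
  have key := (((h (x + δ)).comp_add_const x δ).sub (h x)).const_mul (1 / δ)
  refine key.congr_of_eventuallyEq (.of_forall fun y => ?_)
  simp only [steklov_eq_integral, Pi.sub_apply]
  rw [intervalIntegral.integral_interval_sub_left (hi _ _) (hi _ _)]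

theorem continuous_steklov (δ : ℝ) {f : ℝ → ℝ} (hf : Continuous f) :
    Continuous (steklov δ f) :=
  continuous_iff_continuousAt.2 fun x => (hasDerivAt_steklov δ hf x).continuousAt

theorem steklov_sub (δ : ℝ) {f g : ℝ → ℝ} (hf : Continuous f) (hg : Continuous g) :
    steklov δ (fun x => f x - g x) = fun x => steklov δ f x - steklov δ g x := by
  funext x
  simp only [steklov]
  rw [intervalIntegral.integral_sub (Continuous.intervalIntegrable (by fun_prop) _ _)
    (Continuous.intervalIntegrable (by fun_prop) _ _), mul_sub]

theorem steklov_const_mul (δ c : ℝ) (f : ℝ → ℝ) :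
    steklov δ (fun x => c * f x) = fun x => c * steklov δ f x := by
  funext x
  simp only [steklov, intervalIntegral.integral_const_mul]
  ring

theorem steklov_comp_add_const (δ a : ℝ) (f : ℝ → ℝ) :
    steklov δ (fun x => f (x + a)) = fun x => steklov δ f (x + a) := by
  funext x
  simp only [steklov, add_right_comm]

theorem abs_steklov_le {δ : ℝ} (hδ : 0 < δ) {f : ℝ → ℝ} {C : ℝ} (hC : ∀ x, |f x| ≤ C) (x : ℝ) :
    |steklov δ f x| ≤ C := by
  have h := intervalIntegral.norm_integral_le_of_norm_le_const
    (f := fun t => f (x + t)) (a := 0) (b := δ) (C := C) fun t _ => hC (x + t)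
  rw [Real.norm_eq_abs, sub_zero, abs_of_pos hδ] at h
  rw [steklov, abs_mul, abs_of_pos (one_div_pos.2 hδ), one_div, inv_mul_le_iff₀ hδ]
  linarith

theorem continuous_steklovDiff (δ : ℝ) {f : ℝ → ℝ} (hf : Continuous f) :
    Continuous (steklovDiff δ f) :=
  hf.sub (continuous_steklov δ hf)

theorem continuous_steklovFwdDiff (δ : ℝ) {f : ℝ → ℝ} (hf : Continuous f) :
    Continuous (steklovFwdDiff δ f) := by
  have := continuous_steklov δ hf
  unfold steklovFwdDiff
  fun_prop

theorem abs_steklovDiff_le {δ : ℝ} (hδ : 0 < δ) {f : ℝ → ℝ} {C : ℝ} (hC : ∀ x, |f x| ≤ C)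
    (x : ℝ) : |steklovDiff δ f x| ≤ 2 * C := by
  have := abs_sub (f x) (steklov δ f x)
  have := hC x
  have := abs_steklov_le hδ hC x
  unfold steklovDiff
  linarith

theorem abs_steklovFwdDiff_le {δ : ℝ} (hδ : 0 < δ) {f : ℝ → ℝ} {C : ℝ} (hC : ∀ x, |f x| ≤ C)
    (x : ℝ) : |steklovFwdDiff δ f x| ≤ 2 * C := by
  have := abs_sub (steklov δ f (x + δ)) (steklov δ f x)
  have := abs_steklov_le hδ hC x
  have := abs_steklov_le hδ hC (x + δ)
  unfold steklovFwdDiff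
  linarith

theorem steklov_steklovFwdDiff (δ : ℝ) {f : ℝ → ℝ} (hf : Continuous f) :
    steklov δ (steklovFwdDiff δ f) = steklovFwdDiff δ (steklov δ f) := by
  have h := continuous_steklov δ hf
  unfold steklovFwdDiff
  rw [steklov_sub δ (by fun_prop) h, steklov_comp_add_const]

theorem steklovDiff_steklovFwdDiff (δ : ℝ) {f : ℝ → ℝ} (hf : Continuous f) :
    steklovDiff δ (steklovFwdDiff δ f) = steklovFwdDiff δ (steklovDiff δ f) := by
  have h := continuous_steklov δ hf
  funext x
  have e : steklov δ (steklovDiff δ f) = fun x => steklov δ f x - steklov δ (steklov δ f) x :=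
    steklov_sub δ hf h
  simp only [steklovDiff, steklov_steklovFwdDiff δ hf] at e ⊢
  simp only [steklovFwdDiff, e]
  ring

theorem hasDerivAt_steklov_steklov (δ : ℝ) {f : ℝ → ℝ} (hf : Continuous f) (x : ℝ) :
    HasDerivAt (steklov δ (steklov δ f)) ((1 / δ) * steklovFwdDiff δ f x) x :=
  hasDerivAt_steklov δ (continuous_steklov δ hf) x

/-- First-order Taylor estimate for the Steklov average of a twice differentiable function. -/
theorem abs_steklov_sub_sub_le {δ : ℝ} (hδ : 0 < δ) {u u' u'' : ℝ → ℝ} {K : ℝ}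
    (hu : ∀ x, HasDerivAt u (u' x) x) (hu' : ∀ x, HasDerivAt u' (u'' x) x)
    (hK : ∀ x, |u'' x| ≤ K) (x : ℝ) :
    |steklov δ u x - u x - δ / 2 * u' x| ≤ K * δ ^ 2 / 6 := by
  have hcu : Continuous u := continuous_iff_continuousAt.2 fun y => (hu y).continuousAt
  have h1 (t : ℝ) (ht : 0 ≤ t) : |u' (x + t) - u' x| ≤ K * t := by
    have := Convex.norm_image_sub_le_of_norm_hasDerivWithin_le (s := univ)
      (fun y _ => (hu' y).hasDerivWithinAt) (fun y _ => hK y) convex_univ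
      (mem_univ x) (mem_univ (x + t))
    simpa [abs_of_nonneg ht] using this
  have hd (t : ℝ) : HasDerivAt (fun t => u (x + t) - u x - t * u' x) (u' (x + t) - u' x) t := by
    simpa using (((hu (x + t)).comp_const_add x t).sub_const (u x)).fun_sub
      ((hasDerivAt_id t).mul_const (u' x))
  have h2 (t : ℝ) (ht : 0 ≤ t) : |u (x + t) - u x - t * u' x| ≤ K * t ^ 2 / 2 := by
    refine image_norm_le_of_norm_deriv_right_le_deriv_boundary (a := 0) (b := t)
      (f := fun t => u (x + t) - u x - t * u' x) (f' := fun t => u' (x + t) - u' x)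
      (B := fun t => K * t ^ 2 / 2) (B' := fun t => K * t)
      (fun s _ => (hd s).continuousAt.continuousWithinAt) (fun s _ => (hd s).hasDerivWithinAt)
      (by simp) (fun s => ?_) (fun s hs => h1 s hs.1) (right_mem_Icc.2 ht)
    have := ((hasDerivAt_pow 2 s).const_mul K).div_const 2
    rwa [show K * (((2 : ℕ) : ℝ) * s ^ (2 - 1)) / 2 = K * s by norm_num; ring] at this
  have h3 : steklov δ u x - u x - δ / 2 * u' x =
      (1 / δ) * ∫ t in (0:ℝ)..δ, (u (x + t) - u x - t * u' x) := by
    rw [intervalIntegral.integral_sub (Continuous.intervalIntegrable (by fun_prop) _ _)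
      (Continuous.intervalIntegrable (by fun_prop) _ _),
      intervalIntegral.integral_sub (Continuous.intervalIntegrable (by fun_prop) _ _)
      (Continuous.intervalIntegrable (by fun_prop) _ _)]
    simp only [steklov, intervalIntegral.integral_const, intervalIntegral.integral_mul_const,
      integral_id, smul_eq_mul]
    field_simp
    ring
  have h4 : |∫ t in (0:ℝ)..δ, (u (x + t) - u x - t * u' x)| ≤
      ∫ t in (0:ℝ)..δ, K * t ^ 2 / 2 := by
    rw [← Real.norm_eq_abs]
    exact intervalIntegral.norm_integral_le_of_norm_le hδ.le
      (.of_forall fun t ht => h2 t ht.1.le)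
      (Continuous.intervalIntegrable (u := fun t => K * t ^ 2 / 2) (by fun_prop) _ _)
  have h5 : ∫ t in (0:ℝ)..δ, K * t ^ 2 / 2 = δ * (K * δ ^ 2 / 6) := by
    rw [intervalIntegral.integral_div, intervalIntegral.integral_const_mul, integral_pow]
    norm_num
    ring
  rw [h3, abs_mul, abs_of_pos (one_div_pos.2 hδ), one_div, inv_mul_le_iff₀ hδ, ← h5]
  exact h4

theorem abs_steklovFwdDiff_le_of_steklovDiff {δ : ℝ} (hδ : 0 < δ) {g : ℝ → ℝ} (hg : Continuous g)
    (hb : ∃ C, ∀ x, |g x| ≤ C) {ε : ℝ} (hε : ∀ x, |steklovDiff δ g x| ≤ ε) (x : ℝ) :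
    |steklovFwdDiff δ g x| ≤ 12 * ε := by
  obtain ⟨C, hC⟩ := hb
  have c1 := continuous_steklov δ hg
  have c2 := continuous_steklov δ c1
  have c3 := continuous_steklov δ c2
  have hbdd : BddAbove (range fun x => |steklovFwdDiff δ g x|) :=
    ⟨2 * C, by rintro _ ⟨y, rfl⟩; exact abs_steklovFwdDiff_le hδ hC y⟩
  set M := ⨆ x, |steklovFwdDiff δ g x|
  have hM (y : ℝ) : |steklovFwdDiff δ g y| ≤ M := le_ciSup hbdd y
  have step (y : ℝ) : |steklovFwdDiff δ g y| ≤ 4 * ε + 2 / 3 * M := by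
    have hu' (z : ℝ) : HasDerivAt
        (fun z => (1 / δ) * (steklov δ (steklov δ g) (z + δ) - steklov δ (steklov δ g) z))
        ((1 / δ) * ((1 / δ) * steklovFwdDiff δ g (z + δ) - (1 / δ) * steklovFwdDiff δ g z)) z :=
      (((hasDerivAt_steklov_steklov δ hg (z + δ)).comp_add_const z δ).sub
        (hasDerivAt_steklov_steklov δ hg z)).const_mul (1 / δ)
    have hK (z : ℝ) : |(1 / δ) * ((1 / δ) * steklovFwdDiff δ g (z + δ) -
        (1 / δ) * steklovFwdDiff δ g z)| ≤ 2 * M / δ ^ 2 := by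
      rw [← mul_sub, ← mul_assoc, abs_mul, abs_of_pos (by positivity)]
      have := abs_sub (steklovFwdDiff δ g (z + δ)) (steklovFwdDiff δ g z)
      have := hM z
      have := hM (z + δ)
      rw [show 2 * M / δ ^ 2 = 1 / δ * (1 / δ) * (2 * M) by field_simp]
      gcongr
      linarith
    have taylor := abs_steklov_sub_sub_le hδ (hasDerivAt_steklov δ c2) hu' hK y
    have e1 : 2 * M / δ ^ 2 * δ ^ 2 / 6 = M / 3 := by field_simp; ring
    have e2 : δ / 2 * ((1 / δ) * (steklov δ (steklov δ g) (y + δ) - steklov δ (steklov δ g) y)) =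
        steklovFwdDiff δ (steklov δ g) y / 2 := by
      simp only [steklovFwdDiff]; field_simp
    rw [e1, e2] at taylor
    have s1 : steklov δ (steklovDiff δ g) = steklovDiff δ (steklov δ g) := steklov_sub δ hg c1
    have s2 : steklov δ (steklovDiff δ (steklov δ g)) = steklovDiff δ (steklov δ (steklov δ g)) :=
      steklov_sub δ c1 c2
    have s3 : steklov δ (steklovDiff δ (steklov δ (steklov δ g))) =
      steklovDiff δ (steklov δ (steklov δ (steklov δ g))) := steklov_sub δ c2 c3
    have small : |steklovDiff δ (steklov δ (steklov δ (steklov δ g))) y| ≤ ε := by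
      rw [← s3, ← s2, ← s1]
      exact abs_steklov_le hδ (abs_steklov_le hδ (abs_steklov_le hδ hε)) y
    have comm := congrFun (steklovDiff_steklovFwdDiff δ hg) y
    have near := abs_steklovFwdDiff_le hδ hε y
    rw [← comm, steklovDiff, steklov_steklovFwdDiff δ hg] at near
    rw [steklovDiff] at small
    rw [abs_le] at *
    constructor <;> linarith
  have : M ≤ 4 * ε + 2 / 3 * M := ciSup_le step
  linarith [hM x]

theorem continuous_iterate_steklov (δ : ℝ) (n : ℕ) {f : ℝ → ℝ} (hf : Continuous f) :
    Continuous ((steklov δ)^[n] f) :=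
  Function.Iterate.rec _ hf (fun _ => continuous_steklov δ) n

theorem iterate_steklov_steklovFwdDiff (δ : ℝ) (n : ℕ) {f : ℝ → ℝ} (hf : Continuous f) :
    (steklov δ)^[n] (steklovFwdDiff δ f) = steklovFwdDiff δ ((steklov δ)^[n] f) := by
  induction n with
  | zero => rfl
  | succ n ih =>
    rw [Function.iterate_succ_apply', ih, Function.iterate_succ_apply',
      steklov_steklovFwdDiff δ (continuous_iterate_steklov δ n hf)]

theorem continuous_iterate_steklovDiff (δ : ℝ) (n : ℕ) {f : ℝ → ℝ} (hf : Continuous f) :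
    Continuous ((steklovDiff δ)^[n] f) :=
  Function.Iterate.rec _ hf (fun _ => continuous_steklovDiff δ) n

theorem iterate_steklovDiff_steklovFwdDiff (δ : ℝ) (n : ℕ) {f : ℝ → ℝ} (hf : Continuous f) :
    (steklovDiff δ)^[n] (steklovFwdDiff δ f) = steklovFwdDiff δ ((steklovDiff δ)^[n] f) := by
  induction n with
  | zero => rfl
  | succ n ih =>
    rw [Function.iterate_succ_apply', ih, Function.iterate_succ_apply',
      steklovDiff_steklovFwdDiff δ (continuous_iterate_steklovDiff δ n hf)]

theorem exists_abs_iterate_steklovDiff_le {δ : ℝ} (hδ : 0 < δ) (n : ℕ) {f : ℝ → ℝ}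
    (hb : ∃ C, ∀ x, |f x| ≤ C) : ∃ C, ∀ x, |(steklovDiff δ)^[n] f x| ≤ C :=
  Function.Iterate.rec (fun g : ℝ → ℝ => ∃ C, ∀ x, |g x| ≤ C)
    hb (fun _ ⟨C, hC⟩ => ⟨2 * C, abs_steklovDiff_le hδ hC⟩) n

theorem iteratedDeriv_iterate_steklov {δ : ℝ} (hδ : δ ≠ 0) (r : ℕ) {f : ℝ → ℝ}
    (hf : Continuous f) (x : ℝ) :
    δ ^ r * iteratedDeriv r ((steklov δ)^[2 * r] f) x = (steklovFwdDiff δ)^[r] f x := by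
  induction r generalizing f with
  | zero => simp
  | succ r ih =>
    have hd : deriv ((steklov δ)^[2 * (r + 1)] f) =
        fun x => (1 / δ) * (steklov δ)^[2 * r] (steklovFwdDiff δ f) x := by
      funext y
      rw [iterate_steklov_steklovFwdDiff δ _ hf, mul_add, mul_one, Function.iterate_succ_apply',
        Function.iterate_succ_apply']
      exact (hasDerivAt_steklov_steklov δ (continuous_iterate_steklov δ _ hf) y).deriv
    rw [iteratedDeriv_succ', hd, iteratedDeriv_const_mul_field, Function.iterate_succ_apply,
      ← ih (continuous_steklovFwdDiff δ hf)]
    field_simp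
    ring

theorem abs_iterate_steklovFwdDiff_le {δ : ℝ} (hδ : 0 < δ) (r : ℕ) {g : ℝ → ℝ}
    (hg : Continuous g) (hb : ∃ C, ∀ x, |g x| ≤ C) {ε : ℝ}
    (hε : ∀ x, |(steklovDiff δ)^[r] g x| ≤ ε) (x : ℝ) :
    |(steklovFwdDiff δ)^[r] g x| ≤ 12 ^ r * ε := by
  induction r generalizing g ε with
  | zero => simpa using hε x
  | succ r ih =>
    obtain ⟨C, hC⟩ := hb
    rw [Function.iterate_succ_apply, pow_succ, mul_assoc]
    refine ih (continuous_steklovFwdDiff δ hg) ⟨2 * C, abs_steklovFwdDiff_le hδ hC⟩ fun y => ?_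
    rw [iterate_steklovDiff_steklovFwdDiff δ r hg]
    refine abs_steklovFwdDiff_le_of_steklovDiff hδ (continuous_iterate_steklovDiff δ r hg)
      (exists_abs_iterate_steklovDiff_le hδ r ⟨C, hC⟩) (fun z => ?_) y
    rw [← Function.iterate_succ_apply' (steklovDiff δ)]
    exact hε z

theorem deriv_steklov_iterate_le (f : ℝ → ℝ) (r : ℕ) (hr : 1 ≤ r)
    (hf : ContDiff ℝ (r : ℕ∞) f)
    (hb : ∀ k ≤ r, BddAbove (Set.range fun x => |iteratedDeriv k f x|))
    (δ : ℝ) (hδ : 0 < δ) :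
    δ ^ r * (⨆ x, |iteratedDeriv r ((steklov δ)^[2 * r] f) x|) ≤
      34 ^ r * ⨆ x, |(steklovDiff δ)^[r] f x| := by
  have hbf : ∃ C, ∀ x, |f x| ≤ C := by
    obtain ⟨C, hC⟩ := hb 0 r.zero_le
    exact ⟨C, fun x => by simpa using hC ⟨x, rfl⟩⟩
  obtain ⟨C, hC⟩ := exists_abs_iterate_steklovDiff_le hδ r hbf
  have hε (x : ℝ) : |(steklovDiff δ)^[r] f x| ≤ ⨆ x, |(steklovDiff δ)^[r] f x| :=
    le_ciSup (f := fun x => |(steklovDiff δ)^[r] f x|) ⟨C, by rintro _ ⟨y, rfl⟩; exact hC y⟩ x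
  rw [Real.mul_iSup_of_nonneg (by positivity)]
  refine ciSup_le fun x => ?_
  rw [← abs_of_pos (pow_pos hδ r), ← abs_mul, iteratedDeriv_iterate_steklov hδ.ne' r hf.continuous]
  refine (abs_iterate_steklovFwdDiff_le hδ r hf.continuous hbf hε x).trans ?_
  have := (abs_nonneg _).trans (hε 0)
  gcongr
  norm_num
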